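/- arXiv:2002.10503 — 3 statements merged into one kernel-verified Lean document; each statement's English description precedes it below -/
import Mathlib

section
/- Fix n ≥ 2, w ∈ S_n, and k ∈ {1,…,n−1}. The number of occurrences of σ_k in any reduced decomposition of w is at most PosPair_k(w) + 1. -/
/-- The simple reflection `σ_i = (i, i+1)`, acting on `ℕ` (1-indexed positions/values). -/
def simpleRefl (i : ℕ) : Equiv.Perm ℕ := Equiv.swap i (i + 1)

/-- `w` is a permutation of `{1, …, n}`: it fixes every point outside `[1, n]`. -/
def IsPermOf (n : ℕ) (w : Equiv.Perm ℕ) : Prop :=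
  ∀ x : ℕ, x ∉ Finset.Icc 1 n → w x = x

/-- The Coxeter length of `w`: its number of inversions on `{1, …, n}`. -/
def len (n : ℕ) (w : Equiv.Perm ℕ) : ℕ :=
  ((Finset.Icc 1 n ×ˢ Finset.Icc 1 n).filter fun p => p.1 < p.2 ∧ w p.2 < w p.1).card

/-- `L` is a word for `w`: a list of indices in `[1, n-1]` whose associated product of
simple reflections (read left to right) is `w`. -/
def IsWord (n : ℕ) (w : Equiv.Perm ℕ) (L : List ℕ) : Prop :=
  (∀ i ∈ L, 1 ≤ i ∧ i ≤ n - 1) ∧ (L.map simpleRefl).prod = w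

/-- `L` is a reduced decomposition of `w`. -/
def IsReducedWord (n : ℕ) (w : Equiv.Perm ℕ) (L : List ℕ) : Prop :=
  IsWord n w L ∧ L.length = len n w

/-- `min_k(w)`: the minimum number of occurrences of `σ_k` in a reduced decomposition of `w`. -/
noncomputable def minOcc (n k : ℕ) (w : Equiv.Perm ℕ) : ℕ :=
  sInf {m | ∃ L : List ℕ, IsReducedWord n w L ∧ L.count k = m}

/-- `max_k(w)`: the maximum number of occurrences of `σ_k` in a reduced decomposition of `w`. -/
noncomputable def maxOcc (n k : ℕ) (w : Equiv.Perm ℕ) : ℕ :=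
  sSup {m | ∃ L : List ℕ, IsReducedWord n w L ∧ L.count k = m}

/-- `expat_k(w) = |{w(1),…,w(k)} ∩ {k+1,…,n}|`. -/
def expat (n k : ℕ) (w : Equiv.Perm ℕ) : ℕ :=
  (((Finset.Icc 1 k).image fun i => w i) ∩ Finset.Icc (k + 1) n).card

/-- A `321`-pattern of `w` in positions `i1 < i2 < i3` (within `[1, n]`). -/
def Is321At (n : ℕ) (w : Equiv.Perm ℕ) (i1 i2 i3 : ℕ) : Prop :=
  1 ≤ i1 ∧ i1 < i2 ∧ i2 < i3 ∧ i3 ≤ n ∧ w i3 < w i2 ∧ w i2 < w i1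

/-- A `3412`-pattern of `w` in positions `i1 < i2 < i3 < i4` (within `[1, n]`). -/
def Is3412At (n : ℕ) (w : Equiv.Perm ℕ) (i1 i2 i3 i4 : ℕ) : Prop :=
  1 ≤ i1 ∧ i1 < i2 ∧ i2 < i3 ∧ i3 < i4 ∧ i4 ≤ n ∧
    w i3 < w i4 ∧ w i4 < w i1 ∧ w i1 < w i2

/-- `p` is a position pair at `k`: `p = (i1, i3)` for a `321`-pattern with `i1 ≤ k < i3`,
or `p = (i2, i3)` for a `3412`-pattern with `i2 ≤ k < i3`. -/
def IsPosPair (n k : ℕ) (w : Equiv.Perm ℕ) (p : ℕ × ℕ) : Prop :=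
  (∃ i2, Is321At n w p.1 i2 p.2 ∧ p.1 ≤ k ∧ k < p.2) ∨
  (∃ i1 i4, Is3412At n w i1 p.1 p.2 i4 ∧ p.1 ≤ k ∧ k < p.2)

/-- `p` is a value pair at `k`: `p = (j3, j1)` for a `321`-pattern with values
`j1 < j2 < j3` and `j1 ≤ k < j3`, or `p = (j4, j1)` for a `3412`-pattern with values
`j1 < j2 < j3 < j4` and `j2 ≤ k < j3`. -/
def IsValPair (n k : ℕ) (w : Equiv.Perm ℕ) (p : ℕ × ℕ) : Prop :=
  (∃ i1 i2 i3, Is321At n w i1 i2 i3 ∧ w i3 ≤ k ∧ k < w i1 ∧ p = (w i1, w i3)) ∨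
  (∃ i1 i2 i3 i4, Is3412At n w i1 i2 i3 i4 ∧ w i4 ≤ k ∧ k < w i1 ∧ p = (w i2, w i3))

/-- `PosPair_k(w)`: the number of distinct position pairs at `k` in `w`. -/
noncomputable def posPairCount (n k : ℕ) (w : Equiv.Perm ℕ) : ℕ :=
  Set.ncard {p : ℕ × ℕ | IsPosPair n k w p}

/-- `ValPair_k(w)`: the number of distinct value pairs at `k` in `w`. -/
noncomputable def valPairCount (n k : ℕ) (w : Equiv.Perm ℕ) : ℕ :=
  Set.ncard {p : ℕ × ℕ | IsValPair n k w p}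


def HasStr (n k : ℕ) (w : Equiv.Perm ℕ) : Prop :=
  ∃ p q, 1 ≤ p ∧ p ≤ k ∧ k < q ∧ q ≤ n ∧ w q < w p

lemma sr_left (w : Equiv.Perm ℕ) (a : ℕ) : (w * simpleRefl a) a = w (a+1) := by
  simp [simpleRefl]
lemma sr_right (w : Equiv.Perm ℕ) (a : ℕ) : (w * simpleRefl a) (a+1) = w a := by
  simp [simpleRefl]
lemma sr_ne (w : Equiv.Perm ℕ) (a x : ℕ) (h1 : x ≠ a) (h2 : x ≠ a + 1) :
    (w * simpleRefl a) x = w x := by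
  simp [simpleRefl, Equiv.swap_apply_of_ne_of_ne h1 h2]

lemma sr_app (w : Equiv.Perm ℕ) (a x : ℕ) : (w * simpleRefl a) (simpleRefl a x) = w x := by
  simp [simpleRefl]

lemma sr_def (a x : ℕ) : simpleRefl a x = if x = a then a + 1 else if x = a + 1 then a else x := by
  simp [simpleRefl, Equiv.swap_apply_def]

lemma sr_lt (a x y : ℕ) (h : x < y) (hne : ¬ (x = a ∧ y = a + 1)) :
    simpleRefl a x < simpleRefl a y := by
  simp only [sr_def]; split_ifs <;> omega

lemma sr_ge (a n x : ℕ) (h1 : 1 ≤ a) (h : 1 ≤ x) : 1 ≤ simpleRefl a x := by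
  simp only [sr_def]; split_ifs <;> omega

lemma sr_le (a n x : ℕ) (h2 : a ≠ n) (h : x ≤ n) : simpleRefl a x ≤ n := by
  simp only [sr_def]; split_ifs <;> omega

lemma sr_gt (a n x : ℕ) (h2 : a ≠ n) (h : n < x) : n < simpleRefl a x := by
  simp only [sr_def]; split_ifs <;> omega

lemma sr_sr (a x : ℕ) : simpleRefl a (simpleRefl a x) = x := by
  simp [simpleRefl]

def invs (n : ℕ) (w : Equiv.Perm ℕ) : Finset (ℕ × ℕ) :=
  (Finset.Icc 1 n ×ˢ Finset.Icc 1 n).filter fun p => p.1 < p.2 ∧ w p.2 < w p.1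

lemma mem_invs (n : ℕ) (w : Equiv.Perm ℕ) (p q : ℕ) :
    (p, q) ∈ invs n w ↔ 1 ≤ p ∧ p < q ∧ q ≤ n ∧ w q < w p := by
  simp only [invs, Finset.mem_filter, Finset.mem_product, Finset.mem_Icc]
  constructor
  · rintro ⟨⟨⟨_, _⟩, _, _⟩, _, _⟩; refine ⟨?_, ?_, ?_, ?_⟩ <;> assumption
  · rintro ⟨_, _, _, _⟩; refine ⟨⟨⟨?_, ?_⟩, ?_, ?_⟩, ?_, ?_⟩ <;> first | assumption | omega

lemma invs_sub (n : ℕ) (w : Equiv.Perm ℕ) (a : ℕ) (h1 : 1 ≤ a) (h2 : a ≤ n - 1) (p q : ℕ)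
    (h : (p, q) ∈ invs n (w * simpleRefl a)) (hne : ¬ (p = a ∧ q = a + 1)) :
    (p, q) ∈ (invs n w).image (fun x => (simpleRefl a x.1, simpleRefl a x.2)) := by
  rw [mem_invs] at h
  obtain ⟨b1, b2, b3, b4⟩ := h
  rw [Finset.mem_image]
  refine ⟨(simpleRefl a p, simpleRefl a q), ?_, by simp [sr_sr]⟩
  rw [mem_invs]
  refine ⟨sr_ge a n p h1 b1, sr_lt a p q b2 hne, sr_le a n q (by omega) b3, ?_⟩
  simpa using b4

lemma len_le (n : ℕ) (w : Equiv.Perm ℕ) (a : ℕ) (h1 : 1 ≤ a) (h2 : a ≤ n - 1) :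
    len n (w * simpleRefl a) ≤ len n w + 1 := by
  change (invs n _).card ≤ (invs n w).card + 1
  calc _ ≤ (insert (a, a+1) ((invs n w).image
        (fun x => (simpleRefl a x.1, simpleRefl a x.2)))).card := by
        apply Finset.card_le_card
        rintro ⟨p, q⟩ h
        by_cases hne : p = a ∧ q = a + 1
        · simp [hne]
        · exact Finset.mem_insert_of_mem (invs_sub n w a h1 h2 p q h hne)
    _ ≤ _ := (Finset.card_insert_le _ _).trans (Nat.add_le_add_right Finset.card_image_le 1)

lemma len_le' (n : ℕ) (w : Equiv.Perm ℕ) (a : ℕ) (h1 : 1 ≤ a) (h2 : a ≤ n - 1)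
    (hd : w (a+1) < w a) :
    len n (w * simpleRefl a) ≤ len n w := by
  change (invs n _).card ≤ (invs n w).card
  calc _ ≤ (((invs n w).image
        (fun x => (simpleRefl a x.1, simpleRefl a x.2)))).card := by
        apply Finset.card_le_card
        rintro ⟨p, q⟩ h
        refine invs_sub n w a h1 h2 p q h ?_
        rintro ⟨rfl, rfl⟩
        rw [mem_invs, sr_left, sr_right] at h
        omega
    _ ≤ _ := Finset.card_image_le

lemma len_word (n : ℕ) (L : List ℕ) (h : ∀ i ∈ L, 1 ≤ i ∧ i ≤ n - 1) :
    len n (L.map simpleRefl).prod ≤ L.length := by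
  induction L using List.reverseRecOn with
  | nil =>
    simp only [List.map_nil, List.prod_nil, List.length_nil, Nat.le_zero]
    simp only [len, Finset.card_eq_zero, Finset.filter_eq_empty_iff]
    intro x _ hx
    simp at hx
    omega
  | append_singleton L a ih =>
    have ha := h a (by simp)
    have := ih (fun i hi => h i (by simp [hi]))
    have := len_le n (L.map simpleRefl).prod a ha.1 ha.2
    simp only [List.map_append, List.prod_append, List.map_cons, List.map_nil, List.prod_singleton,
      List.length_append, List.length_singleton]
    omega

lemma pp_finite (n k : ℕ) (w : Equiv.Perm ℕ) : {p : ℕ × ℕ | IsPosPair n k w p}.Finite := by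
  apply Set.Finite.subset (Finset.finite_toSet (Finset.Icc 1 n ×ˢ Finset.Icc 1 n))
  rintro ⟨p, q⟩ h
  simp only [Finset.coe_product, Finset.coe_Icc, Set.mem_prod, Set.mem_Icc]
  rcases h with ⟨i, h, _, _⟩ | ⟨i, j, h, _, _⟩
  · unfold Is321At at h; dsimp only at *; omega
  · unfold Is3412At at h; dsimp only at *; omega

lemma step_ne (n k : ℕ) (w : Equiv.Perm ℕ) (a : ℕ) (h1 : 1 ≤ a) (h2 : a ≤ n - 1) (hak : a ≠ k)
    (ha : w a < w (a+1)) : posPairCount n k w ≤ posPairCount n k (w * simpleRefl a) := by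
  have key : ∀ x y, x < y → w y < w x → simpleRefl a x < simpleRefl a y := by
    intro x y hxy hw
    apply sr_lt a x y hxy
    rintro ⟨rfl, rfl⟩
    omega
  have han : a ≠ n := by omega
  refine Set.ncard_le_ncard_of_injOn (fun x => (simpleRefl a x.1, simpleRefl a x.2)) ?_ ?_
    (pp_finite _ _ _)
  · rintro ⟨p, q⟩ h
    rcases h with ⟨i, ⟨c1, c2, c3, c4, c5, c6⟩, d1, d2⟩ |
      ⟨i, j, ⟨c1, c2, c3, c4, c5, c6, c7, c8⟩, d1, d2⟩
    · left
      refine ⟨simpleRefl a i, ⟨sr_ge a n _ h1 c1, key _ _ c2 c6, key _ _ c3 c5, sr_le a n _ han c4,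
        ?_, ?_⟩, sr_le a k _ hak d1, sr_gt a k _ hak d2⟩
      · simpa only [sr_app] using c5
      · simpa only [sr_app] using c6
    · dsimp only at *
      by_cases e1 : i = a ∧ p = a + 1
      · left
        obtain ⟨rfl, rfl⟩ := e1
        have hq : simpleRefl i q = q := by
          rw [sr_def, if_neg (by omega), if_neg (by omega)]
        have hp : simpleRefl i (i+1) = i := by simp [sr_def]
        refine ⟨i+1, ?_, ?_⟩
        · dsimp only
          rw [hq, hp]
          refine ⟨c1, by omega, by omega, by omega, ?_, ?_⟩
          · rw [sr_right, sr_ne _ _ _ (by omega) (by omega)]; omega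
          · rw [sr_right, sr_left]; omega
        · dsimp only; rw [hq, hp]; omega
      · by_cases e2 : q = a ∧ j = a + 1
        · left
          obtain ⟨rfl, rfl⟩ := e2
          have hp : simpleRefl q p = p := by
            rw [sr_def, if_neg (by omega), if_neg (by omega)]
          have hq : simpleRefl q q = q + 1 := by simp [sr_def]
          refine ⟨q, ?_, ?_⟩
          · dsimp only
            rw [hq, hp]
            refine ⟨by omega, by omega, by omega, by omega, ?_, ?_⟩
            · rw [sr_right, sr_left]; omega
            · rw [sr_left, sr_ne _ _ _ (by omega) (by omega)]; omega
          · dsimp only; rw [hq, hp]; omega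
        · right
          refine ⟨simpleRefl a i, simpleRefl a j, ⟨sr_ge a n _ h1 c1, sr_lt a _ _ c2 e1,
            key _ _ c3 (by omega), sr_lt a _ _ c4 e2, sr_le a n _ han c5,
            ?_, ?_, ?_⟩, sr_le a k _ hak d1, sr_gt a k _ hak d2⟩ <;> simpa only [sr_app]
  · intro x _ y _ h
    simp only [Prod.mk.injEq, EmbeddingLike.apply_eq_iff_eq] at h
    exact Prod.ext h.1 h.2

lemma pp_mono_k (n k : ℕ) (w : Equiv.Perm ℕ) (h1 : 1 ≤ k) (h2 : k ≤ n - 1)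
    (ha : w k < w (k+1)) (p : ℕ × ℕ) (h : IsPosPair n k w p) :
    IsPosPair n k (w * simpleRefl k) p := by
  obtain ⟨p, q⟩ := p
  have hinv : 1 ≤ p ∧ p ≤ k ∧ k < q ∧ q ≤ n ∧ w q < w p := by
    rcases h with ⟨i, ⟨c1, c2, c3, c4, c5, c6⟩, d1, d2⟩ |
      ⟨i, j, ⟨c1, c2, c3, c4, c5, c6, c7, c8⟩, d1, d2⟩ <;> dsimp only at * <;> omega
  obtain ⟨b1, b2, b3, b4, b5⟩ := hinv
  by_cases hp : p = k
  · subst hp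
    have hq : q ≠ p + 1 := by rintro rfl; omega
    left
    refine ⟨p+1, ⟨b1, by simp, by dsimp only; omega, b4, ?_, ?_⟩, le_rfl, b3⟩
    · rw [sr_right, sr_ne _ _ _ (by dsimp only; omega) (by exact hq)]; exact b5
    · rw [sr_right, sr_left]; exact ha
  by_cases hq : q = k + 1
  · subst hq
    left
    refine ⟨k, ⟨b1, by dsimp only; omega, by simp, b4, ?_, ?_⟩, b2, b3⟩
    · rw [sr_right, sr_left]; exact ha
    · rw [sr_left, sr_ne _ _ _ (by exact hp) (by dsimp only; omega)]; exact b5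
  have hvp : (w * simpleRefl k) p = w p := sr_ne _ _ _ hp (by omega)
  have hvq : (w * simpleRefl k) q = w q := sr_ne _ _ _ (by omega) hq
  rcases h with ⟨i, ⟨c1, c2, c3, c4, c5, c6⟩, d1, d2⟩ |
      ⟨i, j, ⟨c1, c2, c3, c4, c5, c6, c7, c8⟩, d1, d2⟩
  · left
    dsimp only at *
    refine ⟨simpleRefl k i, ⟨b1, ?_, ?_, b4, ?_, ?_⟩, b2, b3⟩
    · rw [sr_def]; split_ifs <;> omega
    · rw [sr_def]; split_ifs <;> omega
    · rw [sr_app, hvq]; exact c5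
    · rw [sr_app, hvp]; exact c6
  · right
    dsimp only at *
    have hvi : (w * simpleRefl k) i = w i := sr_ne _ _ _ (by omega) (by omega)
    have hvj : (w * simpleRefl k) j = w j := sr_ne _ _ _ (by omega) (by omega)
    refine ⟨i, j, ⟨c1, c2, c3, c4, c5, ?_, ?_, ?_⟩, b2, b3⟩
    · rw [hvq, hvj]; exact c6
    · rw [hvi, hvj]; exact c7
    · rw [hvi, hvp]; exact c8

lemma pp_new (n k : ℕ) (w : Equiv.Perm ℕ) (h1 : 1 ≤ k) (h2 : k ≤ n - 1)
    (ha : w k < w (k+1)) (hs : HasStr n k w) :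
    ∃ p, IsPosPair n k (w * simpleRefl k) p ∧ ¬ IsPosPair n k w p := by
  by_cases hA : ∃ q, k + 1 < q ∧ q ≤ n ∧ w q < w k
  · obtain ⟨q, hq, hmax⟩ := Finset.exists_max_image
      ((Finset.Icc 1 n).filter fun q => k + 1 < q ∧ q ≤ n ∧ w q < w k) (fun q => w q)
      (by obtain ⟨q, hq⟩ := hA; exact ⟨q, by simp; omega⟩)
    simp only [Finset.mem_filter, Finset.mem_Icc] at hq hmax
    refine ⟨(k, q), Or.inl ⟨k+1, ⟨h1, by simp, by dsimp only; omega, by dsimp only; omega,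
      ?_, ?_⟩, le_rfl, by dsimp only; omega⟩, ?_⟩
    · rw [sr_right, sr_ne _ _ _ (by dsimp only; omega) (by dsimp only; omega)]; dsimp only; omega
    · rw [sr_right, sr_left]; exact ha
    · rintro (⟨i, ⟨c1, c2, c3, c4, c5, c6⟩, d1, d2⟩ |
        ⟨i, j, ⟨c1, c2, c3, c4, c5, c6, c7, c8⟩, d1, d2⟩) <;> dsimp only at *
      · have : i ≠ k + 1 := by rintro rfl; omega
        have := hmax i (by omega)
        omega
      · have := hmax j (by omega)
        omega
  by_cases hB : ∃ p, 1 ≤ p ∧ p < k ∧ w (k+1) < w p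
  · obtain ⟨p, hp, hmin⟩ := Finset.exists_min_image
      ((Finset.Icc 1 n).filter fun p => 1 ≤ p ∧ p < k ∧ w (k+1) < w p) (fun q => w q)
      (by obtain ⟨q, hq⟩ := hB; exact ⟨q, by simp; omega⟩)
    simp only [Finset.mem_filter, Finset.mem_Icc] at hp hmin
    refine ⟨(p, k+1), Or.inl ⟨k, ⟨by dsimp only; omega, by dsimp only; omega, by simp,
      by dsimp only; omega, ?_, ?_⟩, by dsimp only; omega, by simp⟩, ?_⟩
    · rw [sr_right, sr_left]; exact ha
    · rw [sr_left, sr_ne _ _ _ (by dsimp only; omega) (by dsimp only; omega)]; dsimp only; omega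
    · rintro (⟨i, ⟨c1, c2, c3, c4, c5, c6⟩, d1, d2⟩ |
        ⟨i, j, ⟨c1, c2, c3, c4, c5, c6, c7, c8⟩, d1, d2⟩) <;> dsimp only at *
      · have : i ≠ k := by rintro rfl; omega
        have := hmin i (by omega)
        omega
      · have := hmin i (by omega)
        omega
  obtain ⟨p, q, b1, b2, b3, b4, b5⟩ := hs
  push Not at hA hB
  have hq : q ≠ k + 1 := by
    rintro rfl
    rcases Nat.lt_or_ge p k with h | h
    · have := hB p b1 h; omega
    · obtain rfl : p = k := by omega
      omega
  have hp : p ≠ k := by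
    rintro rfl
    have := hA q (by omega) b4
    omega
  have e1 := hA q (by omega) b4
  have e2 := hB p b1 (by omega)
  have e3 : w q ≠ w k := fun h => by have := w.injective h; omega
  have e4 : w p ≠ w (k+1) := fun h => by have := w.injective h; omega
  refine ⟨(k, k+1), Or.inr ⟨p, q, ⟨b1, by dsimp only; omega, by simp, by dsimp only; omega, b4,
    ?_, ?_, ?_⟩, le_rfl, by simp⟩, ?_⟩
  · rw [sr_right, sr_ne _ _ _ (by omega) (by omega)]; omega
  · rw [sr_ne _ _ _ (by omega) (by omega), sr_ne _ _ _ (by omega) (by omega)]; omega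
  · rw [sr_left, sr_ne _ _ _ (by omega) (by omega)]; omega
  · rintro (⟨i, ⟨c1, c2, c3, c4, c5, c6⟩, d1, d2⟩ |
        ⟨i, j, ⟨c1, c2, c3, c4, c5, c6, c7, c8⟩, d1, d2⟩) <;> dsimp only at * <;> omega

lemma step_k (n k : ℕ) (w : Equiv.Perm ℕ) (h1 : 1 ≤ k) (h2 : k ≤ n - 1)
    (ha : w k < w (k+1)) (hs : HasStr n k w) :
    posPairCount n k w + 1 ≤ posPairCount n k (w * simpleRefl k) := by
  apply Set.ncard_lt_ncard _ (pp_finite _ _ _)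
  obtain ⟨p, hp, hp'⟩ := pp_new n k w h1 h2 ha hs
  exact (Set.ssubset_iff_of_subset (fun x hx => pp_mono_k n k w h1 h2 ha x hx)).2 ⟨p, hp, hp'⟩

lemma main_ind (n k : ℕ) (L : List ℕ) (h : ∀ i ∈ L, 1 ≤ i ∧ i ≤ n - 1)
    (hl : L.length = len n (L.map simpleRefl).prod) :
    L.count k ≤ posPairCount n k (L.map simpleRefl).prod + 1 ∧
      (0 < L.count k → HasStr n k (L.map simpleRefl).prod) := by
  induction L using List.reverseRecOn with
  | nil => simp
  | append_singleton L a ih =>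
    have ha := h a (by simp)
    have hL : ∀ i ∈ L, 1 ≤ i ∧ i ≤ n - 1 := fun i hi => h i (by simp [hi])
    simp only [List.map_append, List.prod_append, List.map_cons, List.map_nil, List.prod_singleton,
      List.length_append, List.length_singleton, List.count_append, List.count_singleton] at hl ⊢
    have l1 := len_word n L hL
    generalize (L.map simpleRefl).prod = w at *
    have l2 := len_le n w a ha.1 ha.2
    have hasc : w a < w (a+1) := by
      by_contra hc
      have : w a ≠ w (a+1) := fun h => by have := w.injective h; omega
      have := len_le' n w a ha.1 ha.2 (by omega)
      omega
    obtain ⟨i1, i2⟩ := ih hL (by omega)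
    by_cases hak : a = k
    · subst hak
      simp only [beq_self_eq_true, if_true]
      refine ⟨?_, fun _ => ⟨a, a+1, ha.1, le_rfl, by omega, by omega, ?_⟩⟩
      · rcases Nat.eq_zero_or_pos (L.count a) with h0 | h0
        · omega
        · have := step_k n a w ha.1 ha.2 hasc (i2 h0)
          omega
      · rw [sr_left, sr_right]; exact hasc
    · have : (a == k) = false := by simpa using hak
      simp only [this, Bool.false_eq_true, if_false, add_zero]
      refine ⟨i1.trans (Nat.add_le_add_right (step_ne n k w a ha.1 ha.2 hak hasc) 1), fun h0 => ?_⟩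
      obtain ⟨p, q, b1, b2, b3, b4, b5⟩ := i2 h0
      refine ⟨simpleRefl a p, simpleRefl a q, sr_ge a n _ ha.1 b1, sr_le a k _ hak b2,
        sr_gt a k _ hak b3, sr_le a n _ (by omega) b4, ?_⟩
      simpa only [sr_app] using b5

/-- The number of `σ_k` factors in any reduced decomposition of `w`
is at most `PosPair_k(w) + 1`. -/
theorem count_le_posPair_succ (n : ℕ) (hn : 2 ≤ n) (w : Equiv.Perm ℕ)
    (hw : IsPermOf n w) (k : ℕ) (hk1 : 1 ≤ k) (hk2 : k ≤ n - 1)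
    (L : List ℕ) (hL : IsReducedWord n w L) :
    L.count k ≤ posPairCount n k w + 1 := by
  obtain ⟨⟨h, rfl⟩, hl⟩ := hL
  exact (main_ind n k L h hl).1
end

section
/- Fix n ≥ 3 and k ∈ {1,…,n−1}, and let w0 ∈ S_n be the longest element, w0(i) = n+1−i for all i. Then min_k(w0) = min{k, n−k}. -/
def descW : ℕ → List ℕ
  | 0 => []
  | n + 1 => (n + 1) :: descW n

def longW : ℕ → List ℕ
  | 0 => []
  | n + 1 => longW n ++ descW n

def crossing (k : ℕ) (w : Equiv.Perm ℕ) : Finset ℕ :=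
  (Finset.Icc 1 k).filter fun i => k < w i

theorem sr_apply (i x : ℕ) :
    simpleRefl i x = if x = i then i + 1 else if x = i + 1 then i else x := by
  simp [simpleRefl, Equiv.swap_apply_def]

theorem descW_prod (n x : ℕ) : ((descW n).map simpleRefl).prod x =
    if x = 1 then n + 1 else if 2 ≤ x ∧ x ≤ n + 1 then x - 1 else x := by
  induction n with
  | zero => simp [descW]; split_ifs <;> omega
  | succ n ih =>
    simp only [descW, List.map_cons, List.prod_cons, Equiv.Perm.mul_apply, ih, sr_apply]
    split_ifs <;> omega

theorem longW_prod (n x : ℕ) : ((longW n).map simpleRefl).prod x =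
    if 1 ≤ x ∧ x ≤ n then n + 1 - x else x := by
  induction n generalizing x with
  | zero => simp [longW]; omega
  | succ n ih =>
    simp only [longW, List.map_append, List.prod_append, Equiv.Perm.mul_apply, ih, descW_prod]
    split_ifs <;> omega

theorem descW_length (n : ℕ) : (descW n).length = n := by
  induction n with
  | zero => rfl
  | succ n ih => simp [descW, ih]

theorem descW_mem (n i : ℕ) : i ∈ descW n ↔ 1 ≤ i ∧ i ≤ n := by
  induction n with
  | zero => simp [descW]; omega
  | succ n ih => simp [descW, ih]; omega

theorem descW_count (n k : ℕ) (hk : 1 ≤ k) : (descW n).count k = if k ≤ n then 1 else 0 := by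
  induction n with
  | zero => simp [descW]; omega
  | succ n ih =>
    simp only [descW, List.count_cons, ih, beq_iff_eq]
    split_ifs <;> omega

theorem longW_count (n k : ℕ) (hk : 1 ≤ k) : (longW n).count k = n - k := by
  induction n with
  | zero => simp [longW]
  | succ n ih =>
    simp only [longW, List.count_append, ih, descW_count n k hk]
    split_ifs <;> omega

theorem longW_mem (n i : ℕ) (h : i ∈ longW n) : 1 ≤ i ∧ i ≤ n - 1 := by
  induction n with
  | zero => simp [longW] at h
  | succ n ih =>
    simp only [longW, List.mem_append, descW_mem] at h
    rcases h with h | h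
    · have := ih h; omega
    · omega

theorem longW_length (n : ℕ) : (longW n).length =
    ((Finset.Icc 1 n ×ˢ Finset.Icc 1 n).filter fun p => p.1 < p.2).card := by
  induction n with
  | zero => simp [longW]
  | succ n ih =>
    have h : ((Finset.Icc 1 (n+1) ×ˢ Finset.Icc 1 (n+1)).filter fun p => p.1 < p.2) =
      ((Finset.Icc 1 n ×ˢ Finset.Icc 1 n).filter fun p => p.1 < p.2) ∪
        (Finset.Icc 1 n ×ˢ {n+1}) := by
      ext ⟨a, b⟩
      simp only [Finset.mem_filter, Finset.mem_product, Finset.mem_Icc, Finset.mem_union,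
        Finset.mem_singleton]
      omega
    rw [h, Finset.card_union_of_disjoint, ← ih]
    · simp [longW, descW_length]
    · rw [Finset.disjoint_left]
      rintro ⟨a, b⟩
      simp only [Finset.mem_filter, Finset.mem_product, Finset.mem_Icc,
        Finset.mem_singleton]
      omega

theorem crossing_le (k : ℕ) (L : List ℕ) :
    (crossing k (L.map simpleRefl).prod).card ≤ L.count k := by
  induction L with
  | nil =>
    simp only [crossing, List.map_nil, List.prod_nil, Equiv.Perm.one_apply, List.count_nil,
      Nat.le_zero, Finset.card_eq_zero, Finset.filter_eq_empty_iff, Finset.mem_Icc]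
    intros; omega
  | cons i L ih =>
    simp only [List.map_cons, List.prod_cons, List.count_cons]
    set w := (L.map simpleRefl).prod
    by_cases hik : i = k
    · subst hik
      have : crossing i (simpleRefl i * w) ⊆ insert (w⁻¹ i) (crossing i w) := by
        intro j
        simp only [crossing, Finset.mem_filter, Finset.mem_insert, Equiv.Perm.mul_apply, sr_apply,
          Equiv.Perm.eq_inv_iff_eq]
        split_ifs <;> grind
      have h2 := (Finset.card_le_card this).trans (Finset.card_insert_le _ _)
      simp only [beq_self_eq_true, if_true]
      omega
    · have : crossing k (simpleRefl i * w) = crossing k w := by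
        ext j
        simp only [crossing, Finset.mem_filter, Equiv.Perm.mul_apply, sr_apply]
        split_ifs <;> grind
      rw [this]; omega

theorem conj_prod (n : ℕ) (w : Equiv.Perm ℕ) (hw' : ∀ i ∈ Finset.Icc 1 n, w i = n + 1 - i)
    (L : List ℕ) (hL : ∀ i ∈ L, 1 ≤ i ∧ i ≤ n - 1) :
    ((L.map (fun i => n - i)).map simpleRefl).prod = w * (L.map simpleRefl).prod * w⁻¹ := by
  induction L with
  | nil => simp
  | cons i L ih =>
    have hi := hL i (by simp)
    have h1 : simpleRefl (n - i) = w * simpleRefl i * w⁻¹ := by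
      unfold simpleRefl
      rw [← Equiv.swap_apply_apply, hw' i (by simp; omega), hw' (i+1) (by simp; omega),
        Equiv.swap_comm]
      congr 1 <;> omega
    simp only [List.map_cons, List.prod_cons]
    rw [ih (fun j hj => hL j (by simp [hj])), h1]
    group

/-- Corollary, minimum for the longest element. For `n ≥ 3` and the
longest element `w0` of `S_n` (with `w0(i) = n+1-i` on `[1,n]`),
`min_k(w0) = min{k, n-k}`. -/
theorem minOcc_longest_element (n : ℕ) (hn : 3 ≤ n) (k : ℕ) (hk1 : 1 ≤ k)
    (hk2 : k ≤ n - 1) (w0 : Equiv.Perm ℕ) (hw0 : IsPermOf n w0)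
    (hw0' : ∀ i ∈ Finset.Icc 1 n, w0 i = n + 1 - i) :
    minOcc n k w0 = min k (n - k) := by
  have hprod : ((longW n).map simpleRefl).prod = w0 := by
    ext x
    rw [longW_prod]
    split_ifs with h
    · rw [hw0' x (by simpa using h)]
    · rw [hw0 x (by simpa using h)]
  have hlen : (longW n).length = len n w0 := by
    rw [longW_length, len]
    congr 1
    ext ⟨a, b⟩
    simp only [Finset.mem_filter, Finset.mem_product, and_congr_right_iff]
    rintro ⟨ha, hb⟩
    rw [hw0' a ha, hw0' b hb]
    simp only [Finset.mem_Icc] at ha hb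
    omega
  have hA : n - k ∈ {m | ∃ L : List ℕ, IsReducedWord n w0 L ∧ L.count k = m} :=
    ⟨longW n, ⟨⟨longW_mem n, hprod⟩, hlen⟩, longW_count n k hk1⟩
  have hB : k ∈ {m | ∃ L : List ℕ, IsReducedWord n w0 L ∧ L.count k = m} := by
    refine ⟨(longW n).map (fun i => n - i), ⟨⟨?_, ?_⟩, ?_⟩, ?_⟩
    · intro i hi
      obtain ⟨j, hj, rfl⟩ := List.mem_map.1 hi
      have := longW_mem n j hj
      omega
    · rw [conj_prod n w0 hw0' _ (longW_mem n), hprod]; group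
    · simpa using hlen
    · have h := longW_count n (n - k) (by omega)
      have h2 : ((longW n).map (fun i => n - i)).count k = (longW n).count (n - k) := by
        rw [List.count, List.countP_map, List.count]
        apply List.countP_congr
        intro i hi
        have := longW_mem n i hi
        simp
        omega
      omega
  unfold minOcc
  apply le_antisymm
  · exact le_min (Nat.sInf_le hB) (Nat.sInf_le hA)
  · apply le_csInf ⟨_, hA⟩
    rintro m ⟨L, ⟨⟨_, hL⟩, _⟩, rfl⟩
    have h := crossing_le k L
    rw [hL] at h
    have : crossing k w0 = Finset.Icc 1 (min k (n - k)) := by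
      ext j
      simp only [crossing, Finset.mem_filter, Finset.mem_Icc]
      constructor
      · rintro ⟨h1, h2⟩
        rw [hw0' j (by simp; omega)] at h2
        omega
      · intro h1
        rw [hw0' j (by simp; omega)]
        omega
    rw [this] at h
    simpa using h
end

section
/- Fix n ≥ 3 and k ∈ {1,…,n−1}, and let w0 ∈ S_n be the longest element, w0(i) = n+1−i for all i. Then PosPair_k(w0) = (k−1)(n−k) + (n−k−1) = k(n−k) − 1. -/
/-- For `n ≥ 3` and the longest element `w0` of `S_n`,
`PosPair_k(w0) = (k-1)(n-k) + (n-k-1) = k(n-k) - 1`. -/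
theorem posPairCount_longest_element (n : ℕ) (hn : 3 ≤ n) (k : ℕ) (hk1 : 1 ≤ k)
    (hk2 : k ≤ n - 1) (w0 : Equiv.Perm ℕ) (hw0 : IsPermOf n w0)
    (hw0' : ∀ i ∈ Finset.Icc 1 n, w0 i = n + 1 - i) :
    posPairCount n k w0 = (k - 1) * (n - k) + (n - k - 1) ∧
    posPairCount n k w0 = k * (n - k) - 1 := by
  have hset : {p : ℕ × ℕ | IsPosPair n k w0 p} =
      (((Finset.Icc 1 k ×ˢ Finset.Icc (k + 1) n).erase (k, k + 1) : Finset (ℕ × ℕ)) :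
        Set (ℕ × ℕ)) := by
    ext ⟨a, b⟩
    simp only [Set.mem_setOf_eq, IsPosPair, Is321At, Is3412At, Finset.coe_erase, Set.mem_diff,
      Finset.mem_coe, Finset.mem_product, Finset.mem_Icc, Set.mem_singleton_iff, Prod.mk.injEq]
    constructor
    · rintro (⟨i, h, h1, h2⟩ | ⟨i, j, ⟨h1, h2, h3, h4, h5, h6, h7, h8⟩, _, _⟩)
      · omega
      · rw [hw0' i (by simp; omega), hw0' a (by simp; omega)] at h8
        omega
    · rintro ⟨⟨⟨h1, h2⟩, h3, h4⟩, h5⟩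
      refine Or.inl ⟨a + 1, ?_, h2, by omega⟩
      rw [hw0' a (by simp; omega), hw0' b (by simp; omega), hw0' (a + 1) (by simp; omega)]
      omega
  have hc : posPairCount n k w0 = k * (n - k) - 1 := by
    unfold posPairCount
    rw [hset, Set.ncard_coe_finset, Finset.card_erase_of_mem (by simp; omega)]
    simp
  refine ⟨?_, hc⟩
  rw [hc]
  obtain ⟨m, rfl⟩ : ∃ m, k = m + 1 := ⟨k - 1, by omega⟩
  rw [Nat.add_sub_cancel, Nat.add_mul, one_mul]
  omega
end
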